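/- There exists a constant d (depending only on the universal machine) such that for every nondeterministic communication protocol Π = (𝓡, t) over D = {0,1}^{n₁} × {0,1}^{n₂} and every (x,y) ∈ D: |IC_Π(x,y) − (C(t_{x,y} ∣ Π) − I(x : y : t_{x,y} ∣ Π))| ≤ d·log₂ n + d, where n = max(n₁,n₂). -/

import Mathlib

/-- A machine maps a program and a condition string to at most one output string. -/
abbrev Machine := List Bool → List Bool →. List Bool

/-- Conditional Kolmogorov complexity relative to machine `U`. -/
noncomputable def KC (U : Machine) (x u : List Bool) : ℕ :=
  sInf { k | ∃ p : List Bool, p.length = k ∧ x ∈ U p u }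

/-- `U` is a universal machine. -/
def IsUniversal (U : Machine) : Prop :=
  Partrec₂ U ∧
    ∀ V : Machine, Partrec₂ V →
      ∃ c : ℕ, ∀ p u x, x ∈ V p u → ∃ q : List Bool, x ∈ U q u ∧ q.length ≤ p.length + c

/-- Self-delimiting encoding of a string. -/
def eBits (x : List Bool) : List Bool := (x.map fun b => [b, b]).flatten ++ [true, false]

/-- The fixed computable pairing of strings. -/
def ePair (x y : List Bool) : List Bool := eBits x ++ y

/-- Encoding of a list of strings. -/
def eList (l : List (List Bool)) : List Bool := (l.map eBits).flatten

/-- Conditional mutual information `I(x : y ∣ u)`. -/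
noncomputable def MI (U : Machine) (x y u : List Bool) : ℝ :=
  (KC U x u : ℝ) + KC U y u - KC U (ePair x y) u

/-- Conditional triple information `I(x : y : w ∣ u)`. -/
noncomputable def TI (U : Machine) (x y w u : List Bool) : ℝ :=
  (KC U x u : ℝ) + KC U y u + KC U w u - KC U (ePair x y) u - KC U (ePair x w) u
    - KC U (ePair y w) u + KC U (ePair x (ePair y w)) u

/-- A combinatorial rectangle, given by its list of rows and list of columns. -/
structure Rect where
  rows : List (List Bool)
  cols : List (List Bool)
deriving DecidableEq

/-- Canonical encoding of a rectangle. -/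
def encRect (R : Rect) : List Bool := ePair (eList R.rows) (eList R.cols)

/-- The list of all bit strings of length `n`. -/
def allBV : ℕ → List (List Bool)
  | 0 => [[]]
  | n + 1 => (allBV n).flatMap fun x => [false :: x, true :: x]

/-- A nondeterministic communication protocol over `{0,1}^{n₁} × {0,1}^{n₂}`:
a finite family of rectangles covering the domain together with a transcript
function selecting, for every cell of the domain, a rectangle containing it. -/
structure Protocol (n₁ n₂ : ℕ) where
  rects : List Rect
  trans : List Bool → List Bool → Rect
  rows_len : ∀ R ∈ rects, ∀ s ∈ R.rows, s.length = n₁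
  cols_len : ∀ R ∈ rects, ∀ s ∈ R.cols, s.length = n₂
  trans_mem : ∀ x y : List Bool, x.length = n₁ → y.length = n₂ → trans x y ∈ rects
  trans_row : ∀ x y : List Bool, x.length = n₁ → y.length = n₂ → x ∈ (trans x y).rows
  trans_col : ∀ x y : List Bool, x.length = n₁ → y.length = n₂ → y ∈ (trans x y).cols

/-- The thickness of a cell: the number of rectangles of the protocol containing it. -/
def cellThick {n₁ n₂ : ℕ} (P : Protocol n₁ n₂) (x y : List Bool) : ℕ :=
  P.rects.countP fun R => decide (x ∈ R.rows ∧ y ∈ R.cols)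

/-- The thickness of a rectangle: the maximal thickness of a cell of the rectangle. -/
def rectThick {n₁ n₂ : ℕ} (P : Protocol n₁ n₂) (R : Rect) : ℕ :=
  (R.rows.flatMap fun x => R.cols.map fun y => cellThick P x y).foldr max 0

/-- Canonical encoding of a protocol: the list of its rectangles followed by
the graph of the transcript function on the domain. -/
def encProt {n₁ n₂ : ℕ} (P : Protocol n₁ n₂) : List Bool :=
  ePair (eList (P.rects.map encRect))
    (eList ((allBV n₁).flatMap fun x => (allBV n₂).map fun y => encRect (P.trans x y)))

/-- The internal information cost of a protocol on input `(x, y)`: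
`I(x : t_{x,y} ∣ y, Π) + I(y : t_{x,y} ∣ x, Π)`. -/
noncomputable def ICost {n₁ n₂ : ℕ} (U : Machine) (P : Protocol n₁ n₂) (x y : List Bool) : ℝ :=
  MI U x (encRect (P.trans x y)) (ePair y (encProt P))
    + MI U y (encRect (P.trans x y)) (ePair x (encProt P))

section PrimrecClosure

variable {α β γ : Type*} [Primcodable α] [Primcodable β] [Primcodable γ]

attribute [fun_prop] Primrec

attribute [fun_prop] Primrec.id Primrec.const Primrec.comp Primrec.pair

@[fun_prop]
theorem Primrec.comp_fst {f : α → β × γ} (hf : Primrec f) : Primrec fun a => (f a).1 :=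
  Primrec.fst.comp hf

@[fun_prop]
theorem Primrec.comp_snd {f : α → β × γ} (hf : Primrec f) : Primrec fun a => (f a).2 :=
  Primrec.snd.comp hf

@[fun_prop]
theorem Primrec.comp_append {f g : α → List β} (hf : Primrec f) (hg : Primrec g) :
    Primrec fun a => f a ++ g a :=
  Primrec.list_append.comp hf hg

@[fun_prop]
theorem Primrec.comp_length {f : α → List β} (hf : Primrec f) : Primrec fun a => (f a).length :=
  Primrec.list_length.comp hf

@[fun_prop]
theorem Primrec.comp_getElem? {f : α → List β} {g : α → ℕ} (hf : Primrec f) (hg : Primrec g) :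
    Primrec fun a => (f a)[g a]? :=
  Primrec.list_getElem?.comp hf hg

@[fun_prop]
theorem Primrec.comp_some {f : α → β} (hf : Primrec f) : Primrec fun a => some (f a) :=
  Primrec.option_some.comp hf

@[fun_prop]
theorem Primrec.comp_add {f g : α → ℕ} (hf : Primrec f) (hg : Primrec g) :
    Primrec fun a => f a + g a :=
  Primrec.nat_add.comp hf hg

@[fun_prop]
theorem Primrec.comp_mul {f g : α → ℕ} (hf : Primrec f) (hg : Primrec g) :
    Primrec fun a => f a * g a :=
  Primrec.nat_mul.comp hf hg

@[fun_prop]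
theorem Primrec.comp_pow {f g : α → ℕ} (hf : Primrec f) (hg : Primrec g) :
    Primrec fun a => f a ^ g a :=
  (Primrec₂.unpaired'.1 Nat.Primrec.pow : Primrec₂ fun m n : ℕ => m ^ n).comp hf hg

theorem PrimrecPred.eq_of_primrec {f g : α → β} (hf : Primrec f) (hg : Primrec g) :
    PrimrecPred fun a => f a = g a := by
  classical
  exact Primrec.eq.comp hf hg

theorem PrimrecPred.le_of_primrec {f g : α → ℕ} (hf : Primrec f) (hg : Primrec g) :
    PrimrecPred fun a => f a ≤ g a :=
  Primrec.nat_le.comp hf hg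

/-- The number whose binary digits, least significant first, are the given bits. -/
def bitsVal (l : List Bool) : ℕ := l.foldr (fun b n => 2 * n + b.toNat) 0

@[fun_prop]
theorem Primrec.comp_bitsVal {f : α → List Bool} (hf : Primrec f) :
    Primrec fun a => bitsVal (f a) := by
  have hb : Primrec Bool.toNat := Primrec.dom_bool _
  have hh : Primrec₂ fun (_ : α) (p : Bool × ℕ) => 2 * p.2 + p.1.toNat := by
    unfold Primrec₂
    fun_prop
  exact Primrec.list_foldr hf (Primrec.const 0) hh

@[fun_prop]
theorem Primrec.comp_eBits {f : α → List Bool} (hf : Primrec f) :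
    Primrec fun a => eBits (f a) := by
  have hh : Primrec₂ fun (_ : α) (b : Bool) => [b, b] := Primrec₂.mk
    ((Primrec.dom_bool fun b => [b, b]).comp Primrec.snd)
  have := Primrec.list_flatten.comp (Primrec.list_map hf hh)
  unfold eBits
  fun_prop

@[fun_prop]
theorem Primrec.comp_ePair {f g : α → List Bool} (hf : Primrec f) (hg : Primrec g) :
    Primrec fun a => ePair (f a) (g a) := by
  unfold ePair
  fun_prop

@[fun_prop]
theorem Primrec.comp_eList {f : α → List (List Bool)} (hf : Primrec f) :
    Primrec fun a => eList (f a) := by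
  have hh : Primrec₂ fun (_ : α) (l : List Bool) => eBits l := by
    unfold Primrec₂
    fun_prop
  exact Primrec.list_flatten.comp (Primrec.list_map hf hh)

end PrimrecClosure

theorem exists_bitsVal_eq (s : ℕ) : ∀ i < 2 ^ s, ∃ l : List Bool, l.length = s ∧ bitsVal l = i := by
  induction s with
  | zero => intro i hi; exact ⟨[], rfl, by simp [bitsVal]; omega⟩
  | succ s ih =>
    intro i hi
    obtain ⟨l, hl, hv⟩ := ih (i / 2) (by rw [pow_succ] at hi; omega)
    refine ⟨decide (i % 2 = 1) :: l, by simp [hl], ?_⟩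
    have : bitsVal (decide (i % 2 = 1) :: l) = 2 * bitsVal l + (decide (i % 2 = 1)).toNat := rfl
    rw [this, hv]
    by_cases h : i % 2 = 1 <;> simp [h] <;> omega

theorem eBits_nil : eBits [] = [true, false] := rfl

theorem eBits_cons (b : Bool) (l : List Bool) : eBits (b :: l) = b :: b :: eBits l := rfl

theorem length_eBits (l : List Bool) : (eBits l).length = 2 * l.length + 2 := by
  induction l with
  | nil => rfl
  | cons b l ih => rw [eBits_cons]; simp [ih]; ring

theorem length_ePair (a b : List Bool) : (ePair a b).length = 2 * a.length + 2 + b.length := by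
  simp [ePair, length_eBits]

theorem ePair_inj {a b a' b' : List Bool} : ePair a b = ePair a' b' ↔ a = a' ∧ b = b' := by
  refine ⟨fun h => ?_, fun h => by rw [h.1, h.2]⟩
  induction a generalizing a' with
  | nil =>
    cases a' with
    | nil => simpa [ePair, eBits_nil] using h
    | cons c l => cases c <;> simp [ePair, eBits_nil, eBits_cons] at h
  | cons c l ih =>
    cases a' with
    | nil => cases c <;> simp [ePair, eBits_nil, eBits_cons] at h
    | cons c' l' =>
      simp only [ePair, eBits_cons, List.cons_append, List.cons.injEq] at h
      obtain ⟨h1, h2⟩ := ih h.2.2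
      exact ⟨by rw [h.1, h1], h2⟩

theorem eList_injective : Function.Injective eList := by
  intro l l' h
  induction l generalizing l' with
  | nil =>
    cases l' with
    | nil => rfl
    | cons a l' =>
      have := congrArg List.length h
      simp [eList, length_eBits] at this
      omega
  | cons a l ih =>
    cases l' with
    | nil =>
      have := congrArg List.length h
      simp [eList, length_eBits] at this
    | cons a' l' =>
      obtain ⟨h1, h2⟩ := ePair_inj.1 (show ePair a (eList l) = ePair a' (eList l') from h)
      rw [h1, ih h2]

theorem length_allBV (n : ℕ) : (allBV n).length = 2 ^ n := by
  induction n with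
  | zero => rfl
  | succ n ih => simp [allBV, List.length_flatMap, ih, pow_succ]

/-- Indexing into a concatenation of blocks of equal length. -/
theorem getElem?_flatMap_of_length {α β : Type*} {f : α → List β} {m : ℕ} {l : List α}
    (hf : ∀ a ∈ l, (f a).length = m) {i j : ℕ} {a : α} (hi : l[i]? = some a) (hj : j < m) :
    (l.flatMap f)[i * m + j]? = (f a)[j]? := by
  induction l generalizing i with
  | nil => simp at hi
  | cons b l ih =>
    have hb : (f b).length = m := hf b (by simp)
    cases i with
    | zero =>
      simp only [List.getElem?_cons_zero, Option.some.injEq] at hi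
      subst hi
      rw [List.flatMap_cons, List.getElem?_append_left (by omega)]
      simp
    | succ i =>
      rw [List.flatMap_cons, List.getElem?_append_right (by rw [hb, Nat.succ_mul]; omega), hb]
      have : (i + 1) * m + j - m = i * m + j := by rw [Nat.succ_mul]; omega
      rw [this]
      exact ih (fun a ha => hf a (by simp [ha])) (by simpa using hi)

theorem getElem?_allBV (x : List Bool) : (allBV x.length)[bitsVal x]? = some x := by
  induction x with
  | nil => rfl
  | cons b l ih =>
    have h : bitsVal (b :: l) = bitsVal l * 2 + b.toNat := by
      simp [bitsVal, mul_comm]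
    rw [h, List.length_cons, allBV,
      getElem?_flatMap_of_length (m := 2) (fun _ _ => rfl) ih (by cases b <;> simp)]
    cases b <;> rfl

theorem bitsVal_lt (x : List Bool) : bitsVal x < 2 ^ x.length := by
  have := getElem?_allBV x
  rw [← length_allBV]
  exact (List.getElem?_eq_some_iff.1 this).1

theorem getElem?_table {β : Type*} (f : List Bool → List Bool → β) (x y : List Bool) :
    ((allBV x.length).flatMap fun x' => (allBV y.length).map fun y' => f x' y')[
      bitsVal x * 2 ^ y.length + bitsVal y]? = some (f x y) := by
  rw [getElem?_flatMap_of_length (by simp [length_allBV]) (getElem?_allBV x) (bitsVal_lt y),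
    List.getElem?_map, getElem?_allBV]
  rfl

theorem exists_primrecPred_halts {U : Machine} (hU : Partrec₂ U) :
    ∃ T : ℕ × List Bool × List Bool × List Bool → Prop,
      PrimrecPred T ∧ ∀ p u x, x ∈ U p u ↔ ∃ s, T (s, p, u, x) := by
  obtain ⟨c, hc⟩ := Nat.Partrec.Code.exists_code.1 hU
  refine ⟨fun w => c.evaln w.1 (Encodable.encode (w.2.1, w.2.2.1)) =
    some (Encodable.encode w.2.2.2), ?_, ?_⟩
  · refine PrimrecPred.eq_of_primrec (Nat.Partrec.Code.primrec_evaln.comp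
      (.pair (.pair .fst (.const c)) (Primrec.encode.comp (.pair ?_ ?_))))
      (Primrec.option_some.comp (Primrec.encode.comp ?_))
    · exact Primrec.fst.comp Primrec.snd
    · exact Primrec.fst.comp (Primrec.snd.comp Primrec.snd)
    · exact Primrec.snd.comp (Primrec.snd.comp Primrec.snd)
  · intro p u x
    have h := congrFun hc (Encodable.encode (p, u))
    simp only [Encodable.encodek, Part.coe_some, Part.bind_some] at h
    have : x ∈ U p u ↔ Encodable.encode x ∈ c.eval (Encodable.encode (p, u)) := by
      rw [h]; simp
    rw [this, Nat.Partrec.Code.evaln_complete]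
    rfl

theorem KC_le_length {U : Machine} {p u x : List Bool} (h : x ∈ U p u) : KC U x u ≤ p.length :=
  Nat.sInf_le ⟨p, rfl, h⟩

/-- A string has small complexity when it is the only possible outcome of a primitive recursive
search for witnesses. -/
theorem exists_program_of_search {U : Machine} (hU : IsUniversal U) {W : Type} [Primcodable W]
    {D : (List Bool × List Bool) × W → Prop} (hD : PrimrecPred D)
    {o : W → List Bool} (ho : Primrec o) :
    ∃ c : ℕ, ∀ p u x, (∃ w, D ((p, u), w) ∧ o w = x) → (∀ w, D ((p, u), w) → o w = x) →
      ∃ q : List Bool, x ∈ U q u ∧ q.length ≤ p.length + c := by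
  obtain ⟨hdec, hD'⟩ := hD
  let R : List Bool × List Bool → ℕ → Option (List Bool) := fun a n =>
    (Encodable.decode n : Option W).bind fun w => if D (a, w) then some (o w) else none
  have hR : Primrec₂ R := by
    refine Primrec.option_bind (Primrec.decode.comp Primrec.snd)
      (Primrec.ite ?_ ?_ (Primrec.const none))
    · exact PrimrecPred.comp ⟨hdec, hD'⟩
        (.pair (Primrec.fst.comp Primrec.fst) Primrec.snd)
    · exact Primrec.option_some.comp (ho.comp Primrec.snd)
  have hV : Partrec₂ (fun p u => Nat.rfindOpt (R (p, u)) : Machine) :=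
    Partrec.rfindOpt hR.to_comp
  obtain ⟨c, hc⟩ := hU.2 _ hV
  refine ⟨c, fun p u x hex huniq => hc p u x ?_⟩
  obtain ⟨w, hw, hx⟩ := hex
  have hdom : (Nat.rfindOpt (R (p, u))).Dom := by
    rw [Nat.rfindOpt_dom]
    exact ⟨Encodable.encode w, x, by simp [R, hw, hx]⟩
  obtain ⟨x', hx'⟩ := Part.dom_iff_mem.1 hdom
  obtain ⟨n, hn⟩ := Nat.rfindOpt_spec hx'
  obtain ⟨w', -, hw'⟩ := Option.bind_eq_some_iff.1 hn
  split_ifs at hw' with h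
  have : x' = x := by rw [← huniq w' h]; exact (Option.some.inj hw').symm
  exact this ▸ hx'

theorem exists_KC_le_length {U : Machine} (hU : IsUniversal U) :
    ∃ c : ℕ, ∀ x u, ∃ q : List Bool, x ∈ U q u ∧ q.length ≤ x.length + c := by
  obtain ⟨c, hc⟩ := exists_program_of_search hU (W := List Bool) (D := fun w => w.1.1 = w.2)
    (.eq_of_primrec (by fun_prop) (by fun_prop)) Primrec.id
  exact ⟨c, fun x u => hc x u x ⟨x, rfl, rfl⟩ fun w hw => hw.symm⟩

theorem exists_program {U : Machine} (hU : IsUniversal U) (x u : List Bool) :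
    ∃ p : List Bool, p.length = KC U x u ∧ x ∈ U p u := by
  obtain ⟨c, hc⟩ := exists_KC_le_length hU
  obtain ⟨q, hq, -⟩ := hc x u
  exact Nat.sInf_mem (s := {k | ∃ p : List Bool, p.length = k ∧ x ∈ U p u}) ⟨_, q, rfl, hq⟩

/-- A primitive recursive correspondence does not increase complexity by more than a constant. -/
theorem KC_transform {U : Machine} (hU : IsUniversal U) {W : Type} [Primcodable W]
    {q : W × List Bool → Prop} (hq : PrimrecPred q) {i o : W → List Bool}
    (hi : Primrec i) (ho : Primrec o)
    (hio : ∀ w w' u, q (w, u) → q (w', u) → i w = i w' → o w = o w') :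
    ∃ c : ℕ, ∀ w u, q (w, u) → KC U (o w) u ≤ KC U (i w) u + c := by
  obtain ⟨T, hT, hTU⟩ := exists_primrecPred_halts hU.1
  obtain ⟨c, hc⟩ := exists_program_of_search hU (W := W × ℕ)
    (D := fun w => q (w.2.1, w.1.2) ∧ T (w.2.2, w.1.1, w.1.2, i w.2.1)) (o := fun w => o w.1)
    ((hq.comp (by fun_prop)).and (hT.comp (by fun_prop))) (by fun_prop)
  refine ⟨c, fun w u hw => ?_⟩
  obtain ⟨p, hp, hpU⟩ := exists_program hU (i w) u
  obtain ⟨s, hs⟩ := (hTU _ _ _).1 hpU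
  obtain ⟨r, hr, hlen⟩ := hc p u (o w) ⟨(w, s), ⟨hw, hs⟩, rfl⟩ fun w' hw' =>
    hio _ _ u hw'.1 hw (Part.mem_unique ((hTU _ _ _).2 ⟨_, hw'.2⟩) hpU)
  rw [← hp]
  exact (KC_le_length hr).trans hlen

/-- The distinct values among the first `n` terms of a sequence, in order of appearance. -/
def distinctValues (g : ℕ → Option (List Bool)) : ℕ → List (List Bool)
  | 0 => []
  | n + 1 => (g n).elim (distinctValues g n) fun y =>
      if y ∈ distinctValues g n then distinctValues g n else distinctValues g n ++ [y]

theorem distinctValues_prefix_succ (g : ℕ → Option (List Bool)) (n : ℕ) :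
    distinctValues g n <+: distinctValues g (n + 1) := by
  rw [distinctValues]
  cases g n with
  | none => exact List.prefix_rfl
  | some y =>
    simp only [Option.elim_some]
    split_ifs
    exacts [List.prefix_rfl, List.prefix_append _ _]

theorem distinctValues_prefix_of_le (g : ℕ → Option (List Bool)) {m n : ℕ} (h : m ≤ n) :
    distinctValues g m <+: distinctValues g n := by
  induction n, h using Nat.le_induction with
  | base => exact List.prefix_rfl
  | succ n _ ih => exact ih.trans (distinctValues_prefix_succ g n)

theorem nodup_distinctValues (g : ℕ → Option (List Bool)) (n : ℕ) :
    (distinctValues g n).Nodup := by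
  induction n with
  | zero => exact List.nodup_nil
  | succ n ih =>
    rw [distinctValues]
    cases g n with
    | none => exact ih
    | some y =>
      simp only [Option.elim_some]
      split_ifs with h
      · exact ih
      · rw [← List.concat_eq_append]
        exact ih.concat h

theorem exists_mem_distinctValues (g : ℕ → Option (List Bool)) (y : List Bool) :
    (∃ n, y ∈ distinctValues g n) ↔ ∃ n, g n = some y := by
  constructor
  · rintro ⟨n, hn⟩
    induction n with
    | zero => simp [distinctValues] at hn
    | succ n ih =>
      rw [distinctValues] at hn
      cases hg : g n with
      | none => rw [hg] at hn; exact ih hn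
      | some z =>
        rw [hg, Option.elim_some] at hn
        split_ifs at hn
        · exact ih hn
        · rcases List.mem_append.1 hn with h | h
          · exact ih h
          · exact ⟨n, by rw [hg, List.mem_singleton.1 h]⟩
  · rintro ⟨n, hn⟩
    refine ⟨n + 1, ?_⟩
    rw [distinctValues, hn, Option.elim_some]
    split_ifs with h <;> simp [h]

theorem Primrec.distinctValues {A : Type} [Primcodable A] {g : A → ℕ → Option (List Bool)}
    (hg : Primrec₂ g) : Primrec₂ fun a n => _root_.distinctValues (g a) n := by
  let step : A → ℕ × List (List Bool) → List (List Bool) := fun a s =>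
    Option.casesOn (g a s.1) s.2 fun y => if y ∈ s.2 then s.2 else s.2 ++ [y]
  have hstep : Primrec₂ step := by
    refine Primrec.option_casesOn (hg.comp Primrec.fst (Primrec.fst.comp Primrec.snd))
      (Primrec.snd.comp Primrec.snd) ?_
    have hmem : PrimrecRel fun (l : List (List Bool)) y => y ∈ l :=
      PrimrecRel.of_eq (PrimrecRel.exists_mem_list Primrec.eq) fun l y => by simp
    refine Primrec.ite (hmem.comp ?_ ?_) ?_ (Primrec.list_append.comp ?_ (Primrec.list_cons.comp ?_ (Primrec.const [])))
    all_goals fun_prop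
  refine (Primrec.nat_rec (Primrec.const []) hstep).of_eq fun a n => ?_
  induction n with
  | zero => rfl
  | succ n ih =>
    rw [_root_.distinctValues]
    simp only at ih ⊢
    rw [ih]
    simp only [step]
    cases g a n with
    | none => rfl
    | some y => rfl

theorem exists_enumeration {A W : Type} [Primcodable A] [Primcodable W]
    {D : A × W → Prop} (hD : PrimrecPred D) {o : W → List Bool} (ho : Primrec o) :
    ∃ E : A → ℕ → List (List Bool), Primrec₂ E ∧ ∀ a, (∀ n, (E a n).Nodup) ∧
      (∀ m n, m ≤ n → E a m <+: E a n) ∧ ∀ y, (∃ n, y ∈ E a n) ↔ ∃ w, D (a, w) ∧ o w = y := by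
  obtain ⟨hdec, hD'⟩ := hD
  let g : A → ℕ → Option (List Bool) := fun a n =>
    (Encodable.decode n : Option W).bind fun w => if D (a, w) then some (o w) else none
  have hg : Primrec₂ g := by
    refine Primrec.option_bind (Primrec.decode.comp Primrec.snd)
      (Primrec.ite ?_ ?_ (Primrec.const none))
    · exact PrimrecPred.comp ⟨hdec, hD'⟩
        (.pair (Primrec.fst.comp Primrec.fst) Primrec.snd)
    · exact Primrec.option_some.comp (ho.comp Primrec.snd)
  refine ⟨_, Primrec.distinctValues hg, fun a => ⟨nodup_distinctValues _,
    fun m n => distinctValues_prefix_of_le _, fun y => ?_⟩⟩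
  rw [exists_mem_distinctValues]
  constructor
  · rintro ⟨n, hn⟩
    obtain ⟨w, -, hw⟩ := Option.bind_eq_some_iff.1 hn
    split_ifs at hw with h
    exact ⟨w, h, Option.some.inj hw⟩
  · rintro ⟨w, hw, rfl⟩
    exact ⟨Encodable.encode w, by simp [g, hw]⟩

theorem getElem?_unique_of_prefix_of_le {E : ℕ → List (List Bool)} (hE : ∀ m n, m ≤ n → E m <+: E n)
    {i m n : ℕ} {y z : List Bool} (hy : (E m)[i]? = some y) (hz : (E n)[i]? = some z) :
    y = z := by
  wlog h : m ≤ n generalizing m n y z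
  · exact (this hz hy (by omega)).symm
  have := (List.getElem?_eq_some_iff.1 hy).1
  obtain ⟨t, ht⟩ := hE m n h
  rw [← ht, List.getElem?_append_left this, hy] at hz
  exact Option.some.inj hz

/-- The complexity of a pair is at most the sum of complexities, up to a logarithmic term. -/
theorem KC_pair_le {U : Machine} (hU : IsUniversal U) :
    ∃ c : ℕ, ∀ a b u s, KC U b u < 2 ^ s →
      KC U (ePair b a) u ≤ KC U b u + KC U a (ePair b u) + 2 * s + c := by
  obtain ⟨T, hT, hTU⟩ := exists_primrecPred_halts hU.1
  let D : (List Bool × List Bool) × List Bool × List Bool × List Bool × List Bool × List Bool ×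
      ℕ × ℕ → Prop := fun ⟨⟨p, u⟩, kb, p₁, p₂, b, a, s, s'⟩ =>
    (p = ePair kb (p₁ ++ p₂) ∧ bitsVal kb = p₁.length) ∧
      T (s, p₁, u, b) ∧ T (s', p₂, ePair b u, a)
  have hD : PrimrecPred D :=
    ((PrimrecPred.eq_of_primrec (by fun_prop) (by fun_prop)).and
      (PrimrecPred.eq_of_primrec (by fun_prop) (by fun_prop))).and
      ((hT.comp (by fun_prop)).and (hT.comp (by fun_prop)))
  obtain ⟨c, hc⟩ := exists_program_of_search hU hD
    (o := fun w => ePair w.2.2.2.1 w.2.2.2.2.1) (by fun_prop)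
  refine ⟨c + 2, fun a b u s hs => ?_⟩
  obtain ⟨p₁, hp₁, hb⟩ := exists_program hU b u
  obtain ⟨p₂, hp₂, ha⟩ := exists_program hU a (ePair b u)
  obtain ⟨kb, hkb, hkv⟩ := exists_bitsVal_eq s _ hs
  obtain ⟨s₁, hs₁⟩ := (hTU _ _ _).1 hb
  obtain ⟨s₂, hs₂⟩ := (hTU _ _ _).1 ha
  obtain ⟨r, hr, hlen⟩ := hc (ePair kb (p₁ ++ p₂)) u (ePair b a)
    ⟨(kb, p₁, p₂, b, a, s₁, s₂), ⟨⟨rfl, by rw [hkv, hp₁]⟩, hs₁, hs₂⟩, rfl⟩ (by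
      rintro ⟨kb', p₁', p₂', b', a', s₁', s₂'⟩ ⟨⟨h1, h2⟩, h3, h4⟩
      obtain ⟨rfl, h5⟩ := ePair_inj.1 h1
      obtain ⟨rfl, rfl⟩ := List.append_inj h5 (by omega)
      obtain rfl := Part.mem_unique ((hTU _ _ _).2 ⟨_, h3⟩) hb
      obtain rfl := Part.mem_unique ((hTU _ _ _).2 ⟨_, h4⟩) ha
      rfl)
  have := KC_le_length hr
  rw [length_ePair, List.length_append] at hlen
  omega

/-- The programs of a given length produce at most exponentially many outputs. -/
theorem exists_finset_outputs (U : Machine) (m : ℕ) (u : List Bool) :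
    ∃ Z : Finset (List Bool), Z.card ≤ 2 ^ m ∧ ∀ p z, p.length = m → z ∈ U p u → z ∈ Z := by
  classical
  refine ⟨(Finset.univ : Finset (Fin m → Bool)).image
    fun f => (U (List.ofFn f) u).toOption.getD [], ?_, ?_⟩
  · exact Finset.card_image_le.trans (by simp)
  · rintro p z rfl hz
    refine Finset.mem_image.2 ⟨p.get, Finset.mem_univ _, ?_⟩
    rw [List.ofFn_get, Part.toOption_eq_some_iff.2 hz]
    rfl

/-- The sum of complexities is at most the complexity of a pair, up to a logarithmic term. -/
theorem le_KC_pair {U : Machine} (hU : IsUniversal U) :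
    ∃ c : ℕ, ∀ a b u s, KC U (ePair b a) u < 2 ^ s →
      KC U b u + KC U a (ePair b u) ≤ KC U (ePair b a) u + 6 * s + c := by
  classical
  obtain ⟨T, hT, hTU⟩ := exists_primrecPred_halts hU.1
  let D₁ : (ℕ × List Bool × List Bool) × List Bool × List Bool × ℕ → Prop :=
    fun ⟨⟨m, b, u⟩, p, a, s⟩ => p.length = m ∧ T (s, p, u, ePair b a)
  have hD₁ : PrimrecPred D₁ :=
    (PrimrecPred.eq_of_primrec (by fun_prop) (by fun_prop)).and (hT.comp (by fun_prop))
  obtain ⟨E, hE, hE'⟩ := exists_enumeration hD₁ (o := fun w => w.2.1) (by fun_prop)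
  have hEmem : ∀ m b u n a, a ∈ E (m, b, u) n → ∃ p, p.length = m ∧ ePair b a ∈ U p u := by
    intro m b u n a h
    obtain ⟨⟨p, a', s⟩, ⟨h1, h2⟩, rfl⟩ := ((hE' (m, b, u)).2.2 a).1 ⟨n, h⟩
    exact ⟨p, h1, (hTU _ _ _).2 ⟨s, h2⟩⟩
  let D₂ : (ℕ × ℕ × List Bool) × List Bool × ℕ → Prop :=
    fun ⟨⟨m, k, u⟩, b, n⟩ => 2 ^ k ≤ (E (m, b, u) n).length
  have hD₂ : PrimrecPred D₂ := by
    refine PrimrecPred.le_of_primrec (by fun_prop) (Primrec.list_length.comp (hE.comp ?_ ?_))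
    all_goals fun_prop
  obtain ⟨F, hF, hF'⟩ := exists_enumeration hD₂ (o := fun w => w.1) (by fun_prop)
  let D₃ : (List Bool × List Bool) × List Bool × List Bool × List Bool × List Bool × ℕ ×
      List Bool → Prop := fun ⟨⟨p, v⟩, mb, ib, b, u, n, a⟩ =>
    (p = ePair mb ib ∧ v = ePair b u) ∧ (E (bitsVal mb, b, u) n)[bitsVal ib]? = some a
  have hD₃ : PrimrecPred D₃ := by
    refine ((PrimrecPred.eq_of_primrec (by fun_prop) (by fun_prop)).and
      (PrimrecPred.eq_of_primrec (by fun_prop) (by fun_prop))).and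
      (PrimrecPred.eq_of_primrec (Primrec.list_getElem?.comp (hE.comp ?_ ?_) ?_) ?_)
    all_goals fun_prop
  obtain ⟨c₃, hc₃⟩ := exists_program_of_search hU hD₃ (o := fun w => w.2.2.2.2.2) (by fun_prop)
  let D₄ : (List Bool × List Bool) × List Bool × List Bool × List Bool × ℕ × List Bool → Prop :=
    fun ⟨⟨p, u⟩, mb, kb, ib, n, b⟩ => p = ePair mb (ePair kb ib) ∧
      (F (bitsVal mb, bitsVal kb, u) n)[bitsVal ib]? = some b
  have hD₄ : PrimrecPred D₄ := by
    refine (PrimrecPred.eq_of_primrec (by fun_prop) (by fun_prop)).and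
      (PrimrecPred.eq_of_primrec (Primrec.list_getElem?.comp (hF.comp ?_ ?_) ?_) ?_)
    all_goals fun_prop
  obtain ⟨c₄, hc₄⟩ := exists_program_of_search hU hD₄ (o := fun w => w.2.2.2.2) (by fun_prop)
  refine ⟨c₃ + c₄ + 7, fun a b u s hs => ?_⟩
  obtain ⟨p, hp, hpU⟩ := exists_program hU (ePair b a) u
  set m := KC U (ePair b a) u
  obtain ⟨Z, hZ, hZU⟩ := exists_finset_outputs U m u
  -- the elements enumerated from distinct first components give distinct outputs
  have hsum : ∀ (B : Finset (List Bool)) (N : List Bool → ℕ),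
      ∑ b' ∈ B, (E (m, b', u) (N b')).length ≤ 2 ^ m := by
    intro B N
    refine le_trans (le_of_eq ?_) ((Finset.card_le_card (s := B.biUnion fun b' =>
      (E (m, b', u) (N b')).toFinset.image (ePair b')) (t := Z) ?_).trans hZ)
    · rw [Finset.card_biUnion]
      · refine Finset.sum_congr rfl fun b' _ => ?_
        rw [Finset.card_image_of_injective _ fun _ _ h => (ePair_inj.1 h).2,
          List.toFinset_card_of_nodup ((hE' _).1 _)]
      · intro b₁ _ b₂ _ hne
        refine Finset.disjoint_left.2 fun z h1 h2 => hne ?_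
        obtain ⟨_, -, rfl⟩ := Finset.mem_image.1 h1
        obtain ⟨_, -, h⟩ := Finset.mem_image.1 h2
        exact (ePair_inj.1 h).1.symm
    · intro z hz
      obtain ⟨b', -, hz⟩ := Finset.mem_biUnion.1 hz
      obtain ⟨a', ha', rfl⟩ := Finset.mem_image.1 hz
      obtain ⟨q, hq, hqU⟩ := hEmem _ _ _ _ _ (List.mem_toFinset.1 ha')
      exact hZU q _ hq hqU
  have hlen : ∀ n, (E (m, b, u) n).length ≤ 2 ^ m := fun n => by
    simpa using hsum {b} fun _ => n
  -- the stage at which the enumeration is complete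
  obtain ⟨n₀, hn₀⟩ : ∃ n₀, ∀ n, (E (m, b, u) n).length ≤ (E (m, b, u) n₀).length := by
    have hbdd : BddAbove (Set.range fun n => (E (m, b, u) n).length) :=
      ⟨2 ^ m, by rintro _ ⟨n, rfl⟩; exact hlen n⟩
    obtain ⟨n₀, h⟩ := Nat.sSup_mem (Set.range_nonempty _) hbdd
    exact ⟨n₀, fun n => (le_csSup hbdd ⟨n, rfl⟩).trans h.ge⟩
  obtain ⟨t, ht⟩ := (hTU _ _ _).1 hpU
  obtain ⟨n₁, hn₁⟩ := ((hE' (m, b, u)).2.2 a).2 ⟨(p, a, t), ⟨hp, ht⟩, rfl⟩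
  obtain ⟨i, hi⟩ := List.mem_iff_getElem?.1 hn₁
  have hi₀ : i < (E (m, b, u) n₀).length :=
    (List.getElem?_eq_some_iff.1 hi).1.trans_le (hn₀ n₁)
  set k := Nat.log 2 (E (m, b, u) n₀).length with hk
  have hk₁ : 2 ^ k ≤ (E (m, b, u) n₀).length := Nat.pow_log_le_self 2 (by omega)
  have hk₂ : (E (m, b, u) n₀).length < 2 ^ (k + 1) := Nat.lt_pow_succ_log_self one_lt_two _
  have hkm : k ≤ m := (Nat.pow_le_pow_iff_right one_lt_two).1 (hk₁.trans (hlen n₀))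
  obtain ⟨mb, hmb, hmv⟩ := exists_bitsVal_eq s m hs
  obtain ⟨kb, hkb, hkv⟩ := exists_bitsVal_eq s k (by omega)
  obtain ⟨ib, hib, hiv⟩ := exists_bitsVal_eq (k + 1) i (by omega)
  obtain ⟨r, hr, hrlen⟩ := hc₃ (ePair mb ib) (ePair b u) a
    ⟨(mb, ib, b, u, n₁, a), ⟨⟨rfl, rfl⟩, by rw [hmv, hiv]; exact hi⟩, rfl⟩ (by
      rintro ⟨mb', ib', b', u', n', a'⟩ ⟨⟨h1, h2⟩, h3⟩
      obtain ⟨rfl, rfl⟩ := ePair_inj.1 h1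
      obtain ⟨rfl, rfl⟩ := ePair_inj.1 h2
      rw [hmv, hiv] at h3
      exact getElem?_unique_of_prefix_of_le (hE' (m, b, u)).2.1 h3 hi)
  obtain ⟨n₂, hn₂⟩ := ((hF' (m, k, u)).2.2 b).2 ⟨(b, n₀), hk₁, rfl⟩
  obtain ⟨j, hj⟩ := List.mem_iff_getElem?.1 hn₂
  have hFlen : (F (m, k, u) n₂).length ≤ 2 ^ (m - k) := by
    have h : ∀ b', ∃ n, b' ∈ F (m, k, u) n₂ → 2 ^ k ≤ (E (m, b', u) n).length := by
      intro b'
      by_cases hb' : b' ∈ F (m, k, u) n₂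
      · obtain ⟨⟨_, n⟩, hn, rfl⟩ := ((hF' (m, k, u)).2.2 b').1 ⟨n₂, hb'⟩
        exact ⟨n, fun _ => hn⟩
      · exact ⟨0, fun h => absurd h hb'⟩
    choose N hN using h
    have h1 := Finset.card_nsmul_le_sum (F (m, k, u) n₂).toFinset
      (fun b' => (E (m, b', u) (N b')).length) (2 ^ k) fun b' hb' => hN b' (List.mem_toFinset.1 hb')
    rw [List.toFinset_card_of_nodup ((hF' _).1 _), smul_eq_mul] at h1
    have h2 := h1.trans (hsum _ N)
    rw [show 2 ^ m = 2 ^ (m - k) * 2 ^ k by rw [← pow_add, Nat.sub_add_cancel hkm]] at h2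
    exact Nat.le_of_mul_le_mul_right h2 (by positivity)
  obtain ⟨jb, hjb, hjv⟩ := exists_bitsVal_eq (m - k) j
    ((List.getElem?_eq_some_iff.1 hj).1.trans_le hFlen)
  obtain ⟨r', hr', hrlen'⟩ := hc₄ (ePair mb (ePair kb jb)) u b
    ⟨(mb, kb, jb, n₂, b), ⟨rfl, by rw [hmv, hkv, hjv]; exact hj⟩, rfl⟩ (by
      rintro ⟨mb', kb', jb', n', b'⟩ ⟨h1, h3⟩
      obtain ⟨rfl, h2⟩ := ePair_inj.1 h1
      obtain ⟨rfl, rfl⟩ := ePair_inj.1 h2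
      rw [hmv, hkv, hjv] at h3
      exact getElem?_unique_of_prefix_of_le (hF' (m, k, u)).2.1 h3 hj)
  have h1 := KC_le_length hr
  have h2 := KC_le_length hr'
  rw [length_ePair] at hrlen hrlen'
  rw [length_ePair] at hrlen'
  omega

theorem abs_KC_pair_sub_le {U : Machine} (hU : IsUniversal U) :
    ∃ c : ℕ, ∀ a b u (s : ℕ), KC U b u < 2 ^ s → KC U (ePair b a) u < 2 ^ s →
      |(KC U (ePair b a) u : ℝ) - KC U b u - KC U a (ePair b u)| ≤ 6 * s + c := by
  obtain ⟨c₁, h₁⟩ := KC_pair_le hU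
  obtain ⟨c₂, h₂⟩ := le_KC_pair hU
  refine ⟨c₁ + c₂, fun a b u s hb hab => ?_⟩
  have h₁ : (KC U (ePair b a) u : ℝ) ≤ KC U b u + KC U a (ePair b u) + 2 * s + c₁ := by
    exact_mod_cast h₁ a b u s hb
  have h₂ : (KC U b u : ℝ) + KC U a (ePair b u) ≤ KC U (ePair b a) u + 6 * s + c₂ := by
    exact_mod_cast h₂ a b u s hab
  have hs : (0 : ℝ) ≤ s := s.cast_nonneg
  push_cast
  rw [abs_le]
  constructor <;> linarith [c₁.cast_nonneg (α := ℝ), c₂.cast_nonneg (α := ℝ)]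

/-- The transcript is computable from the inputs and the protocol. -/
theorem KC_pair_trans_le {U : Machine} (hU : IsUniversal U) :
    ∃ c : ℕ, ∀ n₁ n₂ : ℕ, ∀ P : Protocol n₁ n₂, ∀ x y : List Bool,
      x.length = n₁ → y.length = n₂ →
      KC U (ePair x (ePair y (encRect (P.trans x y)))) (encProt P) ≤
        KC U (ePair x y) (encProt P) + c := by
  let q : (List Bool × List Bool × List Bool × List Bool × List (List Bool)) × List Bool → Prop :=
    fun ⟨⟨x, y, t, v, l⟩, u⟩ => u = ePair v (eList l) ∧
      l[bitsVal x * 2 ^ y.length + bitsVal y]? = some t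
  have hq : PrimrecPred q := by
    refine (PrimrecPred.eq_of_primrec (by fun_prop) (by fun_prop)).and
      (PrimrecPred.eq_of_primrec (Primrec.list_getElem?.comp ?_ ?_) ?_)
    all_goals fun_prop
  obtain ⟨c, hc⟩ := KC_transform hU hq (i := fun w => ePair w.1 w.2.1)
    (o := fun w => ePair w.1 (ePair w.2.1 w.2.2.1)) (by fun_prop) (by fun_prop) (by
      rintro ⟨x, y, t, v, l⟩ ⟨x', y', t', v', l'⟩ u ⟨rfl, h⟩ ⟨h1, h'⟩ h2
      obtain ⟨rfl, rfl⟩ := ePair_inj.1 h2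
      obtain rfl := eList_injective (ePair_inj.1 h1).2
      rw [h] at h'
      rw [Option.some.inj h'])
  refine ⟨c, fun n₁ n₂ P x y hx hy => ?_⟩
  subst hx hy
  exact hc (x, y, encRect (P.trans x y), _, _) (encProt P)
    ⟨rfl, getElem?_table (fun x y => encRect (P.trans x y)) x y⟩

theorem KC_triple_transform {U : Machine} (hU : IsUniversal U)
    {i o : List Bool × List Bool × List Bool → List Bool} (hi : Primrec i) (ho : Primrec o)
    (hio : ∀ w w', i w = i w' → o w = o w') :
    ∃ c : ℕ, ∀ w u, KC U (o w) u ≤ KC U (i w) u + c := by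
  obtain ⟨c, hc⟩ := KC_transform hU (q := fun _ => True)
    ⟨inferInstance, by simpa using Primrec.const true⟩ hi ho fun w w' _ _ _ h => hio w w' h
  exact ⟨c, fun w u => hc w u trivial⟩

theorem le_two_pow_log (n c : ℕ) : 3 * n + c < 2 ^ (Nat.log 2 n + c + 3) := by
  have h1 : n < 2 ^ (Nat.log 2 n + 1) := Nat.lt_pow_succ_log_self one_lt_two n
  have h2 : c < 2 ^ c := Nat.lt_two_pow_self
  have h3 : 2 ^ (Nat.log 2 n + c + 3) = 4 * (2 ^ (Nat.log 2 n + 1) * 2 ^ c) := by ring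
  have h4 : n < 2 ^ (Nat.log 2 n + 1) * 2 ^ c := h1.trans_le (Nat.le_mul_of_pos_right _ (by omega))
  have h5 : c < 2 ^ (Nat.log 2 n + 1) * 2 ^ c := h2.trans_le (Nat.le_mul_of_pos_left _ (by omega))
  omega

/-- `IC_Π(x,y) = C(t_{x,y} ∣ Π) - I(x : y : t_{x,y} ∣ Π)` up to `O(log n)` precision. -/
theorem stmt13 (U : Machine) (hU : IsUniversal U) :
    ∃ d : ℝ, ∀ n₁ n₂ : ℕ, ∀ P : Protocol n₁ n₂, ∀ x y : List Bool,
      x.length = n₁ → y.length = n₂ →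
      |ICost U P x y
          - ((KC U (encRect (P.trans x y)) (encProt P) : ℝ)
              - TI U x y (encRect (P.trans x y)) (encProt P))|
        ≤ d * Real.logb 2 (max n₁ n₂) + d := by
  obtain ⟨c₁, hc₁⟩ := KC_pair_trans_le hU
  obtain ⟨c₂, hc₂⟩ := exists_KC_le_length hU
  obtain ⟨c, hc⟩ := abs_KC_pair_sub_le hU
  obtain ⟨e₁, he₁⟩ := KC_triple_transform hU (i := fun w => ePair w.1 (ePair w.2.1 w.2.2))
    (o := fun w => w.1) (by fun_prop) (by fun_prop)
    fun w w' h => by simp only [ePair_inj] at h ⊢; simp [h]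
  obtain ⟨e₂, he₂⟩ := KC_triple_transform hU (i := fun w => ePair w.1 (ePair w.2.1 w.2.2))
    (o := fun w => w.2.1) (by fun_prop) (by fun_prop)
    fun w w' h => by simp only [ePair_inj] at h ⊢; simp [h]
  obtain ⟨e₃, he₃⟩ := KC_triple_transform hU (i := fun w => ePair w.1 (ePair w.2.1 w.2.2))
    (o := fun w => ePair w.1 w.2.1) (by fun_prop) (by fun_prop)
    fun w w' h => by simp only [ePair_inj] at h ⊢; simp [h]
  obtain ⟨e₄, he₄⟩ := KC_triple_transform hU (i := fun w => ePair w.1 (ePair w.2.1 w.2.2))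
    (o := fun w => ePair w.1 w.2.2) (by fun_prop) (by fun_prop)
    fun w w' h => by simp only [ePair_inj] at h ⊢; simp [h]
  obtain ⟨e₅, he₅⟩ := KC_triple_transform hU (i := fun w => ePair w.1 (ePair w.2.1 w.2.2))
    (o := fun w => ePair w.2.1 w.2.2) (by fun_prop) (by fun_prop)
    fun w w' h => by simp only [ePair_inj] at h ⊢; simp [h]
  obtain ⟨e₆, he₆⟩ := KC_triple_transform hU (i := fun w => ePair w.1 (ePair w.2.1 w.2.2))
    (o := fun w => ePair w.2.1 (ePair w.1 w.2.2)) (by fun_prop) (by fun_prop)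
    fun w w' h => by simp only [ePair_inj] at h ⊢; simp [h]
  obtain ⟨e₇, he₇⟩ := KC_triple_transform hU (i := fun w => ePair w.1 w.2.1)
    (o := fun w => ePair w.2.1 w.1) (by fun_prop) (by fun_prop)
    fun w w' h => by simp only [ePair_inj] at h ⊢; simp [h]
  set e := c₁ + e₁ + e₂ + e₃ + e₄ + e₅ + e₆ + e₇ with he
  set K := 2 + c₂ + 2 * e with hK
  refine ⟨36 + (36 * (K + 3) + 6 * c + 5 * e), fun n₁ n₂ P x y hx hy => ?_⟩
  set t := encRect (P.trans x y)
  set u := encProt P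
  have b₁ := he₁ (x, y, t) u
  have b₂ := he₂ (x, y, t) u
  have b₃ := he₃ (x, y, t) u
  have b₄ := he₄ (x, y, t) u
  have b₅ := he₅ (x, y, t) u
  have b₆ := he₆ (x, y, t) u
  have b₆' := he₆ (y, x, t) u
  have b₇ := he₇ (x, y, t) u
  have b₇' := he₇ (y, x, t) u
  have bt : KC U (ePair x (ePair y t)) u ≤ KC U (ePair x y) u + c₁ := hc₁ n₁ n₂ P x y hx hy
  simp only at b₁ b₂ b₃ b₄ b₅ b₆ b₆' b₇ b₇'
  have bxy : KC U (ePair x y) u ≤ 3 * max n₁ n₂ + 2 + c₂ := by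
    obtain ⟨q, hq, hlen⟩ := hc₂ (ePair x y) u
    have := KC_le_length hq
    rw [length_ePair] at hlen
    omega
  set s := Nat.log 2 (max n₁ n₂) + K + 3 with hs
  have hbound : ∀ k : ℕ, k ≤ 3 * max n₁ n₂ + K → k < 2 ^ s := fun k hk =>
    hk.trans_lt (le_two_pow_log _ _)
  have s₁ := hc x y u s (hbound _ (by omega)) (hbound _ (by omega))
  have s₂ := hc t y u s (hbound _ (by omega)) (hbound _ (by omega))
  have s₃ := hc (ePair x t) y u s (hbound _ (by omega)) (hbound _ (by omega))
  have s₄ := hc y x u s (hbound _ (by omega)) (hbound _ (by omega))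
  have s₅ := hc t x u s (hbound _ (by omega)) (hbound _ (by omega))
  have s₆ := hc (ePair y t) x u s (hbound _ (by omega)) (hbound _ (by omega))
  have r₃ : (KC U (ePair x y) u : ℝ) ≤ KC U (ePair x (ePair y t)) u + e := by
    exact_mod_cast (show _ ≤ _ + e by omega)
  have r₆ : (KC U (ePair y (ePair x t)) u : ℝ) ≤ KC U (ePair x (ePair y t)) u + e := by
    exact_mod_cast (show _ ≤ _ + e by omega)
  have r₆' : (KC U (ePair x (ePair y t)) u : ℝ) ≤ KC U (ePair y (ePair x t)) u + e := by
    exact_mod_cast (show _ ≤ _ + e by omega)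
  have r₇ : (KC U (ePair y x) u : ℝ) ≤ KC U (ePair x y) u + e := by
    exact_mod_cast (show _ ≤ _ + e by omega)
  have r₇' : (KC U (ePair x y) u : ℝ) ≤ KC U (ePair y x) u + e := by
    exact_mod_cast (show _ ≤ _ + e by omega)
  have rt : (KC U (ePair x (ePair y t)) u : ℝ) ≤ KC U (ePair x y) u + e := by
    exact_mod_cast (show _ ≤ _ + e by omega)
  have hlog : (s : ℝ) ≤ Real.logb 2 (max n₁ n₂) + (K + 3) := by
    have := Real.natLog_le_logb (max n₁ n₂) 2
    push_cast at this
    rw [hs]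
    push_cast
    linarith
  have hlog₀ : 0 ≤ Real.logb 2 (max n₁ n₂ : ℝ) := by
    have := Real.natLog_le_logb (max n₁ n₂) 2
    push_cast at this
    exact (Nat.cast_nonneg _).trans this
  have hd : (0 : ℝ) ≤ (36 * (K + 3) + 6 * c + 5 * e) * Real.logb 2 (max n₁ n₂ : ℝ) := by
    positivity
  have he₀ : (0 : ℝ) ≤ e := e.cast_nonneg
  rw [abs_le] at s₁ s₂ s₃ s₄ s₅ s₆
  have hmain : |ICost U P x y - ((KC U t u : ℝ) - TI U x y t u)| ≤ 6 * (6 * s + c) + 5 * e := by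
    unfold ICost MI TI
    rw [abs_le]
    constructor <;> linarith
  refine hmain.trans ?_
  rw [add_mul]
  linarith
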